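/- Let S be an inverse semigroup and N a normal inverse subsemigroup of S. If s ≃_N t, then s s⁻¹ ≃_N t t⁻¹, s⁻¹ s ≃_N t⁻¹ t, and s⁻¹ ≃_N t⁻¹. -/

import Mathlib

/-- An inverse semigroup: a semigroup in which every element `s` has a
(unique) inverse `s⁻¹` with `s * s⁻¹ * s = s` and `s⁻¹ * s * s⁻¹ = s⁻¹`. -/
class InverseSemigroup (S : Type*) extends Semigroup S, Inv S where
  mul_inv_mul : ∀ s : S, s * s⁻¹ * s = s
  inv_mul_inv : ∀ s : S, s⁻¹ * s * s⁻¹ = s⁻¹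
  inv_unique : ∀ s t : S, s * t * s = s → t * s * t = t → t = s⁻¹

/-- The natural partial order on an inverse semigroup:
`s ≤ t` iff `s = e * t` for some idempotent `e`. -/
def NatLe {S : Type*} [InverseSemigroup S] (s t : S) : Prop :=
  ∃ e : S, IsIdempotentElem e ∧ s = e * t

/-- A normal inverse subsemigroup: a full inverse subsemigroup that is
closed under conjugation. -/
structure IsNormalInverseSubsemigroup {S : Type*} [InverseSemigroup S] (N : Set S) : Prop where
  mul_mem : ∀ {a b : S}, a ∈ N → b ∈ N → a * b ∈ N
  inv_mem : ∀ {a : S}, a ∈ N → a⁻¹ ∈ N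
  full : ∀ {e : S}, IsIdempotentElem e → e ∈ N
  conj_mem : ∀ (s : S) {n : S}, n ∈ N → s⁻¹ * n * s ∈ N

/-- The preorder `≤_N` associated to a normal inverse subsemigroup `N`:
`s ≤_N t` iff there are `a, b ∈ N` with `a⁻¹ * a = s * s⁻¹`,
`s⁻¹ * s = b * b⁻¹` (so `a · s · b` is a trace product) and `a * s * b ≤ t`. -/
def LeN {S : Type*} [InverseSemigroup S] (N : Set S) (s t : S) : Prop :=
  ∃ a ∈ N, ∃ b ∈ N, a⁻¹ * a = s * s⁻¹ ∧ s⁻¹ * s = b * b⁻¹ ∧ NatLe (a * s * b) t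

/-- The equivalence `≃_N` obtained by symmetrizing `≤_N`. -/
def SimeqN {S : Type*} [InverseSemigroup S] (N : Set S) (s t : S) : Prop :=
  LeN N s t ∧ LeN N t s

namespace InverseSemigroup

variable {S : Type*} [InverseSemigroup S]

protected theorem inv_inv (s : S) : s⁻¹⁻¹ = s :=
  (inv_unique s⁻¹ s (inv_mul_inv s) (mul_inv_mul s)).symm

theorem inv_eq_self {e : S} (he : IsIdempotentElem e) : e⁻¹ = e :=
  (inv_unique e e (by rw [he.eq, he.eq]) (by rw [he.eq, he.eq])).symm

theorem isIdempotentElem_mul_inv (s : S) : IsIdempotentElem (s * s⁻¹) := by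
  rw [IsIdempotentElem, ← mul_assoc, mul_inv_mul]

theorem isIdempotentElem_inv_mul (s : S) : IsIdempotentElem (s⁻¹ * s) := by
  rw [IsIdempotentElem, ← mul_assoc, inv_mul_inv]

theorem isIdempotentElem_mul {e f : S} (he : IsIdempotentElem e) (hf : IsIdempotentElem f) :
    IsIdempotentElem (e * f) := by
  have he' (z : S) : e * (e * z) = e * z := by rw [← mul_assoc, he.eq]
  have hf' (z : S) : f * (f * z) = f * z := by rw [← mul_assoc, hf.eq]
  have h₁ := mul_inv_mul (e * f)
  have h₂ := inv_mul_inv (e * f)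
  have hx : f * (e * f)⁻¹ * e = (e * f)⁻¹ := by
    apply inv_unique
    · simpa only [mul_assoc, he', hf'] using h₁
    · simpa only [mul_assoc, he', hf'] using congrArg (fun z => f * z * e) h₂
  have hi : IsIdempotentElem (e * f)⁻¹ := by
    have h₃ : f * (e * f)⁻¹ * e * (f * (e * f)⁻¹ * e) = f * (e * f)⁻¹ * e := by
      simpa only [mul_assoc] using congrArg (fun z => f * z * e) h₂
    rwa [hx] at h₃
  have h := inv_eq_self hi
  rw [InverseSemigroup.inv_inv] at h
  rwa [← h] at hi

theorem commute_of_isIdempotentElem {e f : S} (he : IsIdempotentElem e)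
    (hf : IsIdempotentElem f) : e * f = f * e := by
  have he' (z : S) : e * (e * z) = e * z := by rw [← mul_assoc, he.eq]
  have hf' (z : S) : f * (f * z) = f * z := by rw [← mul_assoc, hf.eq]
  have hef := isIdempotentElem_mul he hf
  have hfe := isIdempotentElem_mul hf he
  rw [← inv_eq_self hef]
  refine (inv_unique (e * f) (f * e) ?_ ?_).symm
  · simpa only [mul_assoc, he', hf'] using hef.eq
  · simpa only [mul_assoc, he', hf'] using hfe.eq

protected theorem mul_inv_rev (s t : S) : (s * t)⁻¹ = t⁻¹ * s⁻¹ := by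
  have hc := commute_of_isIdempotentElem (isIdempotentElem_inv_mul s) (isIdempotentElem_mul_inv t)
  refine (inv_unique (s * t) (t⁻¹ * s⁻¹) ?_ ?_).symm
  · calc s * t * (t⁻¹ * s⁻¹) * (s * t) = s * ((t * t⁻¹) * (s⁻¹ * s)) * t := by
          simp only [mul_assoc]
      _ = (s * s⁻¹ * s) * (t * t⁻¹ * t) := by rw [← hc]; simp only [mul_assoc]
      _ = s * t := by rw [mul_inv_mul, mul_inv_mul]
  · calc t⁻¹ * s⁻¹ * (s * t) * (t⁻¹ * s⁻¹) = t⁻¹ * ((s⁻¹ * s) * (t * t⁻¹)) * s⁻¹ := by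
          simp only [mul_assoc]
      _ = (t⁻¹ * t * t⁻¹) * (s⁻¹ * s * s⁻¹) := by rw [hc]; simp only [mul_assoc]
      _ = t⁻¹ * s⁻¹ := by rw [inv_mul_inv, inv_mul_inv]

end InverseSemigroup

section

variable {S : Type*} [InverseSemigroup S]

open InverseSemigroup

theorem NatLe.inv {s t : S} (h : NatLe s t) : NatLe s⁻¹ t⁻¹ := by
  obtain ⟨e, he, rfl⟩ := h
  have hc := commute_of_isIdempotentElem he (isIdempotentElem_mul_inv t)
  have key : t⁻¹ * e * t * t⁻¹ = t⁻¹ * e := by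
    calc t⁻¹ * e * t * t⁻¹ = t⁻¹ * (e * (t * t⁻¹)) := by simp only [mul_assoc]
      _ = t⁻¹ * t * t⁻¹ * e := by rw [hc]; simp only [mul_assoc]
      _ = t⁻¹ * e := by rw [inv_mul_inv]
  refine ⟨t⁻¹ * e * t, ?_, ?_⟩
  · calc t⁻¹ * e * t * (t⁻¹ * e * t) = (t⁻¹ * e * t * t⁻¹) * e * t := by simp only [mul_assoc]
      _ = t⁻¹ * e * t := by rw [key, mul_assoc t⁻¹ e e, he.eq]
  · rw [key, InverseSemigroup.mul_inv_rev, inv_eq_self he]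

theorem NatLe.mul_inv {s t : S} (h : NatLe s t) : NatLe (s * s⁻¹) (t * t⁻¹) := by
  obtain ⟨e, he, rfl⟩ := h
  refine ⟨e, he, ?_⟩
  calc e * t * (e * t)⁻¹ = e * (t * t⁻¹ * e) := by
        rw [InverseSemigroup.mul_inv_rev, inv_eq_self he]; simp only [mul_assoc]
    _ = e * (t * t⁻¹) := by
        rw [← commute_of_isIdempotentElem he (isIdempotentElem_mul_inv t), ← mul_assoc, he.eq]

variable {N : Set S} {s t : S}

theorem LeN.inv (hN : IsNormalInverseSubsemigroup N) (h : LeN N s t) : LeN N s⁻¹ t⁻¹ := by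
  obtain ⟨a, ha, b, hb, hab, hba, hle⟩ := h
  refine ⟨b⁻¹, hN.inv_mem hb, a⁻¹, hN.inv_mem ha, ?_, ?_, ?_⟩
  · rw [InverseSemigroup.inv_inv, InverseSemigroup.inv_inv, hba]
  · rw [InverseSemigroup.inv_inv, InverseSemigroup.inv_inv, hab]
  · simpa only [InverseSemigroup.mul_inv_rev, mul_assoc] using hle.inv

theorem LeN.mul_inv (hN : IsNormalInverseSubsemigroup N) (h : LeN N s t) :
    LeN N (s * s⁻¹) (t * t⁻¹) := by
  obtain ⟨a, ha, b, hb, hab, hba, hle⟩ := h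
  have hs := isIdempotentElem_mul_inv s
  refine ⟨a, ha, a⁻¹, hN.inv_mem ha, ?_, ?_, ?_⟩
  · rw [inv_eq_self hs, hs.eq, hab]
  · rw [inv_eq_self hs, hs.eq, InverseSemigroup.inv_inv, hab]
  · have key : a * s * b * (a * s * b)⁻¹ = a * (s * s⁻¹) * a⁻¹ := by
      calc a * s * b * (a * s * b)⁻¹ = a * (s * (b * b⁻¹) * s⁻¹) * a⁻¹ := by
            simp only [InverseSemigroup.mul_inv_rev, mul_assoc]
        _ = a * (s * s⁻¹) * a⁻¹ := by rw [← hba, ← mul_assoc s, mul_inv_mul]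
    exact key ▸ hle.mul_inv

theorem SimeqN.inv (hN : IsNormalInverseSubsemigroup N) (h : SimeqN N s t) :
    SimeqN N s⁻¹ t⁻¹ :=
  ⟨h.1.inv hN, h.2.inv hN⟩

theorem SimeqN.mul_inv (hN : IsNormalInverseSubsemigroup N) (h : SimeqN N s t) :
    SimeqN N (s * s⁻¹) (t * t⁻¹) :=
  ⟨h.1.mul_inv hN, h.2.mul_inv hN⟩

end

/-- If `s ≃_N t` then `s s⁻¹ ≃_N t t⁻¹`, `s⁻¹ s ≃_N t⁻¹ t` and `s⁻¹ ≃_N t⁻¹`. -/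
theorem simeqN_inv_and_idempotents {S : Type*} [InverseSemigroup S] {N : Set S}
    (hN : IsNormalInverseSubsemigroup N) {s t : S} (h : SimeqN N s t) :
    SimeqN N (s * s⁻¹) (t * t⁻¹) ∧ SimeqN N (s⁻¹ * s) (t⁻¹ * t) ∧ SimeqN N s⁻¹ t⁻¹ := by
  refine ⟨h.mul_inv hN, ?_, h.inv hN⟩
  simpa only [InverseSemigroup.inv_inv] using (h.inv hN).mul_inv hN
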